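/- Suppose F satisfies the second-order tail conditions with α_R = 2 and α_L < 2. Then there is a strictly positive finite constant C_L, depending only on c_L and α_L, such that σ²(m/n, k/n) / [ C_L (m/n)^{1−2/α_L} + ∫_{1/2}^{1−k/n} [F⁻(s)]² ds ] → 1 as n → ∞. -/

import Mathlib

open Filter Set Topology MeasureTheory

/-- The generalized inverse (quantile function) of a distribution function `F`:
`F⁻(u) = inf {x : F x ≥ u}`. -/
noncomputable def quantile (F : ℝ → ℝ) (u : ℝ) : ℝ := sInf {x : ℝ | u ≤ F x}

/-- The Lebesgue–Stieltjes measure associated to a nondecreasing function `g`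
(junk value `0` if `g` is not monotone). -/
noncomputable def lsMeasure (g : ℝ → ℝ) : Measure ℝ :=
  open scoped Classical in
  if hg : Monotone g then hg.stieltjesFunction.measure else 0

/-- The quantile function of `F` clamped to `[s, 1 - t]`: a nondecreasing function of `u`
that agrees with `F⁻` on `[s, 1 - t]`. -/
noncomputable def clampedQuantile (F : ℝ → ℝ) (s t u : ℝ) : ℝ :=
  quantile F (max s (min u (1 - t)))

/-- `σ²(s,t) = ∫_s^{1-t} ∫_s^{1-t} (u ∧ v - u v) dF⁻(u) dF⁻(v)`, the double
Lebesgue–Stieltjes integral over `(s, 1-t]` with respect to the nondecreasing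
function `F⁻`. -/
noncomputable def sigmaSq (F : ℝ → ℝ) (s t : ℝ) : ℝ :=
  ∫ u in Ioc s (1 - t), ∫ v in Ioc s (1 - t), (min u v - u * v)
    ∂(lsMeasure (clampedQuantile F s t)) ∂(lsMeasure (clampedQuantile F s t))

/-- Second-order right-tail condition: as `x → ∞`,
`1 - F x = c * x^(-α) * (1 + b * x^(-β) + o (x^(-β)))`. -/
def RightTailSecondOrder (F : ℝ → ℝ) (c α b β : ℝ) : Prop :=
  Tendsto (fun x : ℝ => ((1 - F x) / (c * x ^ (-α)) - 1) * x ^ β) atTop (nhds b)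

/-- Second-order left-tail condition: as `x → ∞`,
`F (-x) = c * x^(-α) * (1 + b * x^(-β) + o (x^(-β)))`. -/
def LeftTailSecondOrder (F : ℝ → ℝ) (c α b β : ℝ) : Prop :=
  Tendsto (fun x : ℝ => (F (-x) / (c * x ^ (-α)) - 1) * x ^ β) atTop (nhds b)

/-- `F` is a distribution function: nondecreasing, right-continuous, with limits
`0` at `-∞` and `1` at `+∞`. -/
structure IsDistributionFunction (F : ℝ → ℝ) : Prop where
  mono : Monotone F
  right_continuous : ∀ x : ℝ, ContinuousWithinAt F (Ici x) x
  tendsto_atTop : Tendsto F atTop (nhds 1)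
  tendsto_atBot : Tendsto F atBot (nhds 0)


lemma MonotoneOn.intervalIntegrable_sq {g : ℝ → ℝ} {a b : ℝ} (hg : MonotoneOn g (Icc a b))
    (hab : a ≤ b) : IntervalIntegrable (fun w => g w ^ 2) volume a b := by
  have hgi : IntervalIntegrable g volume a b :=
    MonotoneOn.intervalIntegrable (by rwa [uIcc_of_le hab])
  have h : IntervalIntegrable (fun w => (g b - g w) ^ 2) volume a b := by
    refine AntitoneOn.intervalIntegrable ?_
    rw [uIcc_of_le hab]
    intro x hx y hy hxy
    have h1 := hg hx hy hxy
    have h2 := hg hy (right_mem_Icc.2 hab) hy.2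
    exact pow_le_pow_left₀ (by linarith) (by linarith) 2
  have h2 : (fun w => g w ^ 2) = fun w => (g b - g w) ^ 2 - g b ^ 2 + 2 * g b * g w := by
    ext w; ring
  rw [h2]
  exact (h.sub intervalIntegrable_const).add (hgi.const_mul _)

/-- Hoeffding's covariance identity for the uniform distribution, in terms of the tail function
`w ↦ ν (w, ∞)` of a finite measure carried by `[0, 1]`. -/
lemma integral_integral_min_sub_mul (ν : Measure ℝ) [IsFiniteMeasure ν]
    (hν : ∀ᵐ u ∂ν, u ∈ Icc (0 : ℝ) 1) :
    ∫ u, ∫ v, (min u v - u * v) ∂ν ∂ν =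
      (∫ w in (0 : ℝ)..1, ν.real (Ioi w) ^ 2) - (∫ w in (0 : ℝ)..1, ν.real (Ioi w)) ^ 2 := by
  set l : Measure ℝ := volume.restrict (Ioc 0 1) with hl
  let e : ℝ → ℝ → ℝ := fun u w => if w < u then 1 else 0
  have hem : Measurable (Function.uncurry e) :=
    Measurable.ite (measurableSet_lt measurable_snd measurable_fst) measurable_const
      measurable_const
  have heb : ∀ u w, ‖e u w‖ ≤ 1 := by
    intro u w; simp only [e]; split_ifs <;> simp
  have he1 : ∀ u ∈ Icc (0 : ℝ) 1, ∫ w, e u w ∂l = u := by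
    intro u hu
    have h : e u = (Iio u).indicator 1 := by
      ext w; simp [e, indicator_apply]
    rw [h, integral_indicator_one measurableSet_Iio, hl, measureReal_restrict_apply
      measurableSet_Iio]
    have h2 : (Iio u ∩ Ioc 0 1 : Set ℝ) =ᵐ[volume] (Ioc 0 u : Set ℝ) := by
      have h3 : Iio u ∩ Ioc 0 1 = Ioo 0 u := by
        ext w
        simp only [mem_inter_iff, mem_Iio, mem_Ioc, mem_Ioo]
        constructor
        · rintro ⟨h1, h2, h3⟩; exact ⟨h2, h1⟩
        · rintro ⟨h1, h2⟩; exact ⟨h2, h1, by linarith [hu.2]⟩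
      rw [h3]
      exact Ioo_ae_eq_Ioc
    rw [measureReal_congr h2]
    simp [hu.1]
  have he2 : ∀ u ∈ Icc (0 : ℝ) 1, ∀ v ∈ Icc (0 : ℝ) 1, ∫ w, e u w * e v w ∂l = min u v := by
    intro u hu v hv
    have h : (fun w => e u w * e v w) = e (min u v) := by
      ext w
      simp only [e, lt_min_iff]
      by_cases h1 : w < u <;> by_cases h2 : w < v <;> simp [h1, h2]
    rw [h, he1 _ ⟨le_min hu.1 hv.1, min_le_of_left_le hu.2⟩]
  have he3 : ∀ w, ∫ u, e u w ∂ν = ν.real (Ioi w) := by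
    intro w
    have h : (fun u => e u w) = (Ioi w).indicator 1 := by
      ext u; simp [e, indicator_apply]
    rw [h, integral_indicator_one measurableSet_Ioi]
  have hNm : Measurable fun w => ν.real (Ioi w) := by
    have : Antitone fun w => ν.real (Ioi w) := fun a b hab =>
      measureReal_mono (Ioi_subset_Ioi hab)
    exact this.measurable
  have hNb : ∀ w, ‖ν.real (Ioi w)‖ ≤ ν.real univ := by
    intro w
    rw [Real.norm_of_nonneg measureReal_nonneg]
    exact measureReal_mono (subset_univ _)
  have hmean : ∫ u, u ∂ν = ∫ w, ν.real (Ioi w) ∂l := by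
    have h1 : ∫ u, u ∂ν = ∫ u, ∫ w, e u w ∂l ∂ν :=
      integral_congr_ae (hν.mono fun u hu => (he1 u hu).symm)
    rw [h1, integral_integral_swap]
    · simp_rw [he3]
    · exact Integrable.of_bound hem.aestronglyMeasurable 1 (ae_of_all _ fun p => heb _ _)
  have hmin : ∫ u, ∫ v, min u v ∂ν ∂ν = ∫ w, ν.real (Ioi w) ^ 2 ∂l := by
    have h1 : ∫ u, ∫ v, min u v ∂ν ∂ν = ∫ u, ∫ w, e u w * ν.real (Ioi w) ∂l ∂ν := by
      refine integral_congr_ae (hν.mono fun u hu => ?_)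
      have h2 : ∫ v, min u v ∂ν = ∫ v, ∫ w, e u w * e v w ∂l ∂ν :=
        integral_congr_ae (hν.mono fun v hv => (he2 u hu v hv).symm)
      simp only
      rw [h2, integral_integral_swap]
      · simp_rw [integral_const_mul, he3]
      · refine Integrable.of_bound (Measurable.aestronglyMeasurable ?_) 1
          (ae_of_all _ fun p => ?_)
        · exact (hem.comp (measurable_const.prodMk measurable_snd)).mul hem
        · simp only [Function.uncurry, norm_mul]
          exact mul_le_one₀ (heb _ _) (norm_nonneg _) (heb _ _)
    rw [h1, integral_integral_swap]
    · simp_rw [integral_mul_const, he3, sq]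
    · refine Integrable.of_bound (Measurable.aestronglyMeasurable ?_) (1 * ν.real univ)
          (ae_of_all _ fun p => ?_)
      · exact hem.mul (hNm.comp measurable_snd)
      · simp only [Function.uncurry, norm_mul]
        exact mul_le_mul (heb _ _) (hNb _) (norm_nonneg _) zero_le_one
  have hprod : ∀ᵐ p ∂(ν.prod ν), p.1 ∈ Icc (0 : ℝ) 1 ∧ p.2 ∈ Icc (0 : ℝ) 1 := by
    refine (Measure.quasiMeasurePreserving_fst.ae hν).and
      (Measure.quasiMeasurePreserving_snd.ae hν)
  have habs : ∀ x ∈ Icc (0 : ℝ) 1, ‖x‖ ≤ 1 := fun x hx => by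
    rw [Real.norm_of_nonneg hx.1]; exact hx.2
  have hsub := integral_integral_sub (μ := ν) (ν := ν)
    (f := fun p : ℝ × ℝ => min p.1 p.2) (g := fun p => p.1 * p.2)
    (Integrable.of_bound (measurable_fst.min measurable_snd).aestronglyMeasurable 1
      (hprod.mono fun p hp => habs _
        ⟨le_min hp.1.1 hp.2.1, min_le_of_left_le hp.1.2⟩))
    (Integrable.of_bound (measurable_fst.mul measurable_snd).aestronglyMeasurable 1
      (hprod.mono fun p hp => habs _
        ⟨mul_nonneg hp.1.1 hp.2.1, mul_le_one₀ hp.1.2 hp.2.1 hp.2.2⟩))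
  rw [hsub, hmin]
  have hmul : ∫ u, ∫ v, u * v ∂ν ∂ν = (∫ u, u ∂ν) * ∫ u, u ∂ν := by
    rw [← integral_mul_const]
    congr 1
    ext u
    exact integral_const_mul u fun v => v
  rw [hmul, hmean, intervalIntegral.integral_of_le zero_le_one,
    intervalIntegral.integral_of_le zero_le_one, sq]

/-- The double Stieltjes integral of `u ∧ v - u v` over `(a, b] ⊆ [0, 1]` with respect to a
monotone function is the variance of that function clamped to the values `g (a+)` and `g b`. -/
lemma integral_min_sub_mul_stieltjes {g : ℝ → ℝ} (hg : Monotone g) {a b : ℝ} (ha : 0 ≤ a)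
    (hab : a ≤ b) (hb : b ≤ 1) (hgb : ∀ u, b ≤ u → g u = g b) :
    ∫ u in Ioc a b, ∫ v in Ioc a b, (min u v - u * v)
        ∂hg.stieltjesFunction.measure ∂hg.stieltjesFunction.measure =
      a * Function.rightLim g a ^ 2 + (1 - b) * g b ^ 2 + (∫ u in a..b, g u ^ 2) -
        (a * Function.rightLim g a + (1 - b) * g b + ∫ u in a..b, g u) ^ 2 := by
  set μ := hg.stieltjesFunction.measure with hμ
  set A := Function.rightLim g a with hA
  have hfin : IsFiniteMeasure (μ.restrict (Ioc a b)) := by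
    refine isFiniteMeasure_restrict.2 ?_
    rw [hμ, StieltjesFunction.measure_Ioc]; exact ENNReal.ofReal_ne_top
  have hgbr : Function.rightLim g b = g b := by
    refine ContinuousWithinAt.rightLim_eq (continuousWithinAt_const.congr (fun y hy => ?_) rfl)
    exact hgb y hy
  have hIoc : ∀ w ∈ Icc a b, μ.real (Ioc w b) = g b - Function.rightLim g w := by
    intro w hw
    rw [measureReal_def, hμ, StieltjesFunction.measure_Ioc, Monotone.stieltjesFunction_eq,
      Monotone.stieltjesFunction_eq, hgbr, ENNReal.toReal_ofReal]
    have := hg.rightLim hw.2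
    rw [hgbr] at this; linarith
  set N : ℝ → ℝ := fun w => (μ.restrict (Ioc a b)).real (Ioi w) with hN
  have hN1 : ∀ w, w ≤ a → N w = g b - A := by
    intro w hw
    rw [hN, ← hIoc a ⟨le_rfl, hab⟩]
    simp only
    rw [measureReal_restrict_apply measurableSet_Ioi]
    congr 1
    ext x; simp only [mem_inter_iff, mem_Ioi, mem_Ioc]
    exact ⟨fun h => h.2, fun h => ⟨lt_of_le_of_lt hw h.1, h⟩⟩
  have hN2 : ∀ w ∈ Icc a b, N w = g b - Function.rightLim g w := by
    intro w hw
    rw [hN, ← hIoc w hw]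
    simp only
    rw [measureReal_restrict_apply measurableSet_Ioi]
    congr 1
    ext x; simp only [mem_inter_iff, mem_Ioi, mem_Ioc]
    exact ⟨fun h => ⟨h.1, h.2.2⟩, fun h => ⟨h.1, lt_of_le_of_lt hw.1 h.1, h.2⟩⟩
  have hN3 : ∀ w, b ≤ w → N w = 0 := by
    intro w hw
    rw [hN]
    simp only
    rw [measureReal_restrict_apply measurableSet_Ioi]
    have : Ioi w ∩ Ioc a b = ∅ := by
      ext x; simp only [mem_inter_iff, mem_Ioi, mem_Ioc, mem_empty_iff_false, iff_false]
      rintro ⟨h1, h2, h3⟩; linarith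
    simp [this]
  have hae : ∀ᵐ w, Function.rightLim g w = g w := by
    have := hg.countable_not_continuousAt.ae_notMem volume
    filter_upwards [this] with w hw
    exact (not_not.1 hw).continuousWithinAt.rightLim_eq
  have hNanti : Antitone N := fun x y hxy => measureReal_mono (Ioi_subset_Ioi hxy)
  have hNsq : Antitone fun w => N w ^ 2 := fun x y hxy =>
    pow_le_pow_left₀ measureReal_nonneg (hNanti hxy) 2
  have hsplit : ∀ φ : ℝ → ℝ, φ 0 = 0 → (Antitone fun w => φ (N w)) →
      ∫ w in (0 : ℝ)..1, φ (N w) = a * φ (g b - A) + ∫ w in a..b, φ (g b - g w) := by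
    intro φ hφ hanti
    have hi : ∀ x y, IntervalIntegrable (fun w => φ (N w)) volume x y := fun x y =>
      hanti.intervalIntegrable
    rw [← intervalIntegral.integral_add_adjacent_intervals (hi 0 a) (hi a 1),
      ← intervalIntegral.integral_add_adjacent_intervals (hi a b) (hi b 1)]
    have e1 : ∫ w in (0 : ℝ)..a, φ (N w) = a * φ (g b - A) := by
      rw [intervalIntegral.integral_congr (g := fun _ => φ (g b - A))]
      · simp
      · intro w hw
        rw [uIcc_of_le ha] at hw
        simp only [hN1 w hw.2]
    have e2 : ∫ w in a..b, φ (N w) = ∫ w in a..b, φ (g b - g w) := by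
      refine intervalIntegral.integral_congr_ae ?_
      filter_upwards [hae] with w hw hwm
      rw [uIoc_of_le hab] at hwm
      rw [hN2 w ⟨hwm.1.le, hwm.2⟩, hw]
    have e3 : ∫ w in b..1, φ (N w) = 0 := by
      rw [intervalIntegral.integral_congr (g := fun _ => 0)]
      · simp
      · intro w hw
        rw [uIcc_of_le hb] at hw
        simp only [hN3 w hw.1, hφ]
    rw [e1, e2, e3, add_zero]
  have hgi : IntervalIntegrable g volume a b := hg.intervalIntegrable
  have hgsq : IntervalIntegrable (fun w => g w ^ 2) volume a b :=
    (hg.monotoneOn _).intervalIntegrable_sq hab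
  have hI1 := hsplit (fun x => x) rfl hNanti
  have hI2 := hsplit (fun x => x ^ 2) (by simp) hNsq
  have hJ1 : ∫ w in a..b, (g b - g w) = (b - a) * g b - ∫ w in a..b, g w := by
    rw [intervalIntegral.integral_sub intervalIntegrable_const hgi]; simp
  have hJ2 : ∫ w in a..b, (g b - g w) ^ 2 =
      (b - a) * g b ^ 2 - 2 * g b * (∫ w in a..b, g w) + ∫ w in a..b, g w ^ 2 := by
    have h2 : (fun w => (g b - g w) ^ 2) = fun w => g b ^ 2 - 2 * g b * g w + g w ^ 2 := by
      ext w; ring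
    rw [h2, intervalIntegral.integral_add (intervalIntegrable_const.sub (hgi.const_mul _)) hgsq,
      intervalIntegral.integral_sub intervalIntegrable_const (hgi.const_mul _),
      intervalIntegral.integral_const_mul]
    simp
  rw [integral_integral_min_sub_mul]
  · rw [hI1, hI2, hJ1, hJ2]
    ring
  · filter_upwards [ae_restrict_mem measurableSet_Ioc] with u hu
    exact ⟨by linarith [hu.1], by linarith [hu.2]⟩

lemma IsDistributionFunction.quantile_le_iff {F : ℝ → ℝ} (hF : IsDistributionFunction F)
    {u : ℝ} (hu : u ∈ Ioo (0 : ℝ) 1) {x : ℝ} : quantile F u ≤ x ↔ u ≤ F x := by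
  have hne : {x : ℝ | u ≤ F x}.Nonempty :=
    ((hF.tendsto_atTop.eventually (lt_mem_nhds hu.2)).exists).imp fun x hx => hx.le
  have hbdd : BddBelow {x : ℝ | u ≤ F x} := by
    obtain ⟨y, hy⟩ := (hF.tendsto_atBot.eventually (gt_mem_nhds hu.1)).exists
    refine ⟨y, fun x hx => ?_⟩
    by_contra h
    have h1 : u ≤ F x := hx
    have h2 := hF.mono (not_le.1 h).le
    linarith
  constructor
  · intro h
    have hev : ∀ᶠ y in 𝓝[>] x, u ≤ F y := by
      filter_upwards [self_mem_nhdsWithin] with y (hy : x < y)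
      obtain ⟨z, hz, hzy⟩ := (csInf_lt_iff hbdd hne).1 (lt_of_le_of_lt h hy)
      have h1 : u ≤ F z := hz
      exact h1.trans (hF.mono hzy.le)
    exact ge_of_tendsto ((hF.right_continuous x).mono Ioi_subset_Ici_self) hev
  · intro h
    exact csInf_le hbdd h

lemma IsDistributionFunction.monotoneOn_quantile {F : ℝ → ℝ} (hF : IsDistributionFunction F) :
    MonotoneOn (quantile F) (Ioo 0 1) := fun _ hu _ hv huv =>
  (hF.quantile_le_iff hu).2 (huv.trans ((hF.quantile_le_iff hv).1 le_rfl))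

/-- A second-order tail expansion implies the first-order one. -/
lemma tendsto_mul_rpow_of_second_order {G : ℝ → ℝ} {c α b β : ℝ} (hc : 0 < c) (hβ : 0 < β)
    (h : Tendsto (fun x : ℝ => (G x / (c * x ^ (-α)) - 1) * x ^ β) atTop (𝓝 b)) :
    Tendsto (fun x : ℝ => G x * x ^ α) atTop (𝓝 c) := by
  have h1 := ((h.mul (tendsto_rpow_neg_atTop hβ)).const_add 1).const_mul c
  rw [mul_zero, add_zero, mul_one] at h1
  refine h1.congr' ?_
  filter_upwards [eventually_gt_atTop 0] with x hx
  have hxβ : x ^ β ≠ 0 := (Real.rpow_pos_of_pos hx β).ne'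
  have hxα : x ^ α ≠ 0 := (Real.rpow_pos_of_pos hx α).ne'
  rw [Real.rpow_neg hx.le, Real.rpow_neg hx.le]
  field_simp
  ring

lemma tendsto_div_rpow_atTop {d r : ℝ} (hd : 0 < d) (hr : 0 < r) :
    Tendsto (fun u : ℝ => (d / u) ^ r) (𝓝[>] 0) atTop :=
  (tendsto_rpow_atTop hr).comp (tendsto_inv_nhdsGT_zero.const_mul_atTop hd)

/-- The quantile function near `0` when the left tail is asymptotic to a power. -/
lemma IsDistributionFunction.tendsto_quantile_mul_rpow {F : ℝ → ℝ}
    (hF : IsDistributionFunction F) {c α : ℝ} (hc : 0 < c) (hα : 0 < α)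
    (h : Tendsto (fun x : ℝ => F (-x) * x ^ α) atTop (𝓝 c)) :
    Tendsto (fun u => quantile F u * u ^ (1 / α)) (𝓝[>] 0) (𝓝 (-c ^ (1 / α))) := by
  have hr : 0 < 1 / α := by positivity
  have hcont : Tendsto (fun d : ℝ => d ^ (1 / α)) (𝓝 c) (𝓝 (c ^ (1 / α))) :=
    (Real.continuousAt_rpow_const c (1 / α) (Or.inl hc.ne')).tendsto
  have hpow : ∀ d u : ℝ, 0 < d → 0 < u → ((d / u) ^ (1 / α)) ^ α = d / u := by
    intro d u hd hu
    rw [← Real.rpow_mul (by positivity), one_div_mul_cancel hα.ne', Real.rpow_one]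
  have hmul : ∀ d u : ℝ, 0 < d → 0 < u → (d / u) ^ (1 / α) * u ^ (1 / α) = d ^ (1 / α) := by
    intro d u hd hu
    rw [← Real.mul_rpow (by positivity) hu.le, div_mul_cancel₀ _ hu.ne']
  have hlt1 : ∀ᶠ u : ℝ in 𝓝[>] 0, u < 1 :=
    mem_nhdsWithin_of_mem_nhds (gt_mem_nhds zero_lt_one)
  rw [tendsto_order]
  constructor
  · intro a ha
    have e1 : ∀ᶠ d in 𝓝[>] c, d ^ (1 / α) < -a :=
      (hcont.eventually (gt_mem_nhds (by linarith))).filter_mono nhdsWithin_le_nhds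
    obtain ⟨d, hd, hcd⟩ := (e1.and self_mem_nhdsWithin).exists
    have hcd : c < d := hcd
    have hd0 : 0 < d := hc.trans hcd
    filter_upwards [(tendsto_div_rpow_atTop hd0 hr).eventually (h.eventually (gt_mem_nhds hcd)),
      self_mem_nhdsWithin, hlt1] with u hu (hu0 : 0 < u) hu1
    rw [hpow d u hd0 hu0] at hu
    have h2 : F (-(d / u) ^ (1 / α)) < u := by
      have h3 : F (-(d / u) ^ (1 / α)) * (d / u) < u * (d / u) := by
        rwa [mul_div_cancel₀ _ hu0.ne']
      exact lt_of_mul_lt_mul_right h3 (by positivity)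
    have h4 : -(d / u) ^ (1 / α) < quantile F u := by
      by_contra hcon
      exact absurd ((hF.quantile_le_iff ⟨hu0, hu1⟩).1 (not_lt.1 hcon)) (not_le.2 h2)
    have h5 := mul_lt_mul_of_pos_right h4 (Real.rpow_pos_of_pos hu0 (1 / α))
    rw [neg_mul, hmul d u hd0 hu0] at h5
    linarith
  · intro a ha
    have e1 : ∀ᶠ d in 𝓝[<] c, -a < d ^ (1 / α) ∧ 0 < d :=
      ((hcont.eventually (lt_mem_nhds (by linarith))).and (lt_mem_nhds hc)).filter_mono
        nhdsWithin_le_nhds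
    obtain ⟨d, ⟨hd, hd0⟩, hcd⟩ := (e1.and self_mem_nhdsWithin).exists
    have hcd : d < c := hcd
    filter_upwards [(tendsto_div_rpow_atTop hd0 hr).eventually (h.eventually (lt_mem_nhds hcd)),
      self_mem_nhdsWithin, hlt1] with u hu (hu0 : 0 < u) hu1
    rw [hpow d u hd0 hu0] at hu
    have h2 : u ≤ F (-(d / u) ^ (1 / α)) := by
      have h3 : u * (d / u) ≤ F (-(d / u) ^ (1 / α)) * (d / u) := by
        rw [mul_div_cancel₀ _ hu0.ne']; exact hu.le
      exact le_of_mul_le_mul_right h3 (by positivity)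
    have h4 : quantile F u ≤ -(d / u) ^ (1 / α) := (hF.quantile_le_iff ⟨hu0, hu1⟩).2 h2
    have h5 := mul_le_mul_of_nonneg_right h4 (Real.rpow_pos_of_pos hu0 (1 / α)).le
    rw [neg_mul, hmul d u hd0 hu0] at h5
    linarith

/-- Growth bound for the quantile function near `1` when the right tail is asymptotic to a
power. -/
lemma IsDistributionFunction.exists_abs_quantile_one_sub_mul_rpow_le {F : ℝ → ℝ}
    (hF : IsDistributionFunction F) {c α : ℝ} (hc : 0 < c) (hα : 0 < α)
    (h : Tendsto (fun x : ℝ => (1 - F x) * x ^ α) atTop (𝓝 c)) :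
    ∃ M, ∀ᶠ t in 𝓝[>] (0 : ℝ), |quantile F (1 - t)| * t ^ (1 / α) ≤ M := by
  have hr : 0 < 1 / α := by positivity
  have hd0 : 0 < c + 1 := by positivity
  have hlt1 : ∀ᶠ u : ℝ in 𝓝[>] 0, u < 1 / 2 :=
    mem_nhdsWithin_of_mem_nhds (gt_mem_nhds one_half_pos)
  refine ⟨|quantile F (1 / 2)| + (c + 1) ^ (1 / α), ?_⟩
  filter_upwards [(tendsto_div_rpow_atTop hd0 hr).eventually
    (h.eventually (gt_mem_nhds (lt_add_one c))), self_mem_nhdsWithin, hlt1]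
    with t ht (ht0 : 0 < t) ht1
  rw [← Real.rpow_mul (by positivity), one_div_mul_cancel hα.ne', Real.rpow_one] at ht
  have h2 : 1 - F (((c + 1) / t) ^ (1 / α)) < t := by
    have h3 : (1 - F (((c + 1) / t) ^ (1 / α))) * ((c + 1) / t) < t * ((c + 1) / t) := by
      rwa [mul_div_cancel₀ _ ht0.ne']
    exact lt_of_mul_lt_mul_right h3 (by positivity)
  have hmem : 1 - t ∈ Ioo (0 : ℝ) 1 := ⟨by linarith, by linarith⟩
  have h4 : quantile F (1 - t) ≤ ((c + 1) / t) ^ (1 / α) :=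
    (hF.quantile_le_iff hmem).2 (by linarith)
  have h5 : quantile F (1 / 2) ≤ quantile F (1 - t) :=
    hF.monotoneOn_quantile ⟨by norm_num, by norm_num⟩ hmem (by linarith)
  have h6 : |quantile F (1 - t)| ≤ |quantile F (1 / 2)| + ((c + 1) / t) ^ (1 / α) := by
    have hpos : 0 ≤ ((c + 1) / t) ^ (1 / α) := by positivity
    rw [abs_le]
    constructor
    · linarith [neg_abs_le (quantile F (1 / 2))]
    · linarith [abs_nonneg (quantile F (1 / 2))]
  have h7 : t ^ (1 / α) ≤ 1 := Real.rpow_le_one ht0.le (by linarith) hr.le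
  have h8 : ((c + 1) / t) ^ (1 / α) * t ^ (1 / α) = (c + 1) ^ (1 / α) := by
    rw [← Real.mul_rpow (by positivity) ht0.le, div_mul_cancel₀ _ ht0.ne']
  calc |quantile F (1 - t)| * t ^ (1 / α)
      ≤ (|quantile F (1 / 2)| + ((c + 1) / t) ^ (1 / α)) * t ^ (1 / α) :=
        mul_le_mul_of_nonneg_right h6 (by positivity)
    _ = |quantile F (1 / 2)| * t ^ (1 / α) + (c + 1) ^ (1 / α) := by rw [add_mul, h8]
    _ ≤ |quantile F (1 / 2)| + (c + 1) ^ (1 / α) := by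
        gcongr
        exact mul_le_of_le_one_right (abs_nonneg _) h7

/-- A monotone function on `(0, 1)` with power growth of exponents less than `1` at both
endpoints is integrable. -/
lemma MonotoneOn.integrableOn_Ioo_of_rpow_bounds {q : ℝ → ℝ} (hq : MonotoneOn q (Ioo 0 1))
    {r₀ r₁ M₀ M₁ : ℝ} (hr₀ : r₀ < 1) (hr₁ : r₁ < 1)
    (h₀ : ∀ᶠ u in 𝓝[>] (0 : ℝ), |q u| * u ^ r₀ ≤ M₀)
    (h₁ : ∀ᶠ t in 𝓝[>] (0 : ℝ), |q (1 - t)| * t ^ r₁ ≤ M₁) :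
    IntegrableOn q (Ioo 0 1) := by
  obtain ⟨a, ha0, ha⟩ := mem_nhdsGT_iff_exists_Ioo_subset.1 (h₀.and
    (mem_nhdsWithin_of_mem_nhds (gt_mem_nhds (one_half_pos (α := ℝ)))))
  obtain ⟨b, hb0, hb⟩ := mem_nhdsGT_iff_exists_Ioo_subset.1 (h₁.and
    (mem_nhdsWithin_of_mem_nhds (gt_mem_nhds (one_half_pos (α := ℝ)))))
  have ha0 : 0 < a := ha0
  have hb0 : 0 < b := hb0
  set a' := a / 2
  set b' := b / 2
  have ha' : a' ∈ Ioo 0 a := ⟨half_pos ha0, half_lt_self ha0⟩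
  have hb' : b' ∈ Ioo 0 b := ⟨half_pos hb0, half_lt_self hb0⟩
  have ha2 : a' < 1 / 2 := (ha ha').2
  have hb2 : b' < 1 / 2 := (hb hb').2
  have hM₀ : 0 ≤ M₀ :=
    (mul_nonneg (abs_nonneg _) (Real.rpow_nonneg ha'.1.le _)).trans (ha ha').1
  have hM₁ : 0 ≤ M₁ :=
    (mul_nonneg (abs_nonneg _) (Real.rpow_nonneg hb'.1.le _)).trans (hb hb').1
  have hi₀ : IntegrableOn (fun u : ℝ => u ^ (-r₀)) (Ioo 0 1) :=
    ((intervalIntegrable_iff_integrableOn_Ioo_of_le zero_le_one).1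
      (intervalIntegral.intervalIntegrable_rpow' (by linarith)))
  have hi₁ : IntegrableOn (fun u : ℝ => (1 - u) ^ (-r₁)) (Ioo 0 1) := by
    have := (intervalIntegral.intervalIntegrable_rpow' (a := 1) (b := 0) (r := -r₁)
      (by linarith)).comp_sub_left 1
    simp only [sub_self, sub_zero] at this
    exact (intervalIntegrable_iff_integrableOn_Ioo_of_le zero_le_one).1 this
  have hi₂ : IntegrableOn (fun _ : ℝ => |q a'| + |q (1 - b')|) (Ioo (0 : ℝ) 1) :=
    integrableOn_const (by simp)
  refine Integrable.mono' (((hi₀.const_mul M₀).add (hi₁.const_mul M₁)).add hi₂)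
    (aemeasurable_restrict_of_monotoneOn measurableSet_Ioo hq).aestronglyMeasurable ?_
  filter_upwards [ae_restrict_mem measurableSet_Ioo] with u hu
  simp only [Pi.add_apply, Real.norm_eq_abs]
  have p0 : 0 ≤ M₀ * u ^ (-r₀) := mul_nonneg hM₀ (Real.rpow_nonneg hu.1.le _)
  have hu1 : 0 < 1 - u := by linarith [hu.2]
  have p1 : 0 ≤ M₁ * (1 - u) ^ (-r₁) := mul_nonneg hM₁ (Real.rpow_nonneg hu1.le _)
  have p2 := abs_nonneg (q a')
  have p3 := abs_nonneg (q (1 - b'))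
  rcases lt_or_ge u a' with h1 | h1
  · have h2 := (ha ⟨hu.1, h1.trans ha'.2⟩).1
    have h3 : |q u| ≤ M₀ * u ^ (-r₀) := by
      rw [Real.rpow_neg hu.1.le, ← div_eq_mul_inv, le_div_iff₀ (Real.rpow_pos_of_pos hu.1 _)]
      exact h2
    linarith
  rcases lt_or_ge (1 - b') u with h4 | h4
  · have h2 := (hb ⟨hu1, (by linarith [hb'.2] : 1 - u < b)⟩).1
    rw [sub_sub_cancel] at h2
    have h3 : |q u| ≤ M₁ * (1 - u) ^ (-r₁) := by
      rw [Real.rpow_neg hu1.le, ← div_eq_mul_inv, le_div_iff₀ (Real.rpow_pos_of_pos hu1 _)]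
      exact h2
    linarith
  · have h5 := hq ⟨ha'.1, by linarith⟩ hu h1
    have h6 := hq hu ⟨by linarith, by linarith [hb'.1]⟩ h4
    have h7 : |q u| ≤ |q a'| + |q (1 - b')| := by
      rw [abs_le]
      constructor
      · linarith [neg_abs_le (q a')]
      · linarith [le_abs_self (q (1 - b'))]
    linarith

lemma tendsto_rpow_nhdsGT_zero {r : ℝ} (hr : 0 < r) :
    Tendsto (fun s : ℝ => s ^ r) (𝓝[>] 0) (𝓝 0) := by
  have := (Real.continuousAt_rpow_const 0 r (Or.inr hr.le)).tendsto
  rw [Real.zero_rpow hr.ne'] at this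
  exact this.mono_left nhdsWithin_le_nhds

lemma integral_rpow_neg_eq {s b p : ℝ} (hs : 0 < s) (hb : 0 < b) (hp : 1 < p) :
    ∫ u in s..b, u ^ (-p) = (s ^ (1 - p) - b ^ (1 - p)) / (p - 1) := by
  have hp0 : p - 1 ≠ 0 := by linarith
  have hp1 : 1 - p ≠ 0 := by linarith
  rw [integral_rpow (Or.inr ⟨by linarith, notMem_uIcc_of_lt hs hb⟩)]
  rw [show -p + 1 = 1 - p by ring]
  field_simp
  ring

lemma tendsto_rpow_mul_integral_of_tendsto_zero {f : ℝ → ℝ} {b p : ℝ} (hb : 0 < b) (hp : 1 < p)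
    (hf : ∀ s, 0 < s → s ≤ b → IntervalIntegrable f volume s b)
    (h : Tendsto (fun u => f u * u ^ p) (𝓝[>] 0) (𝓝 0)) :
    Tendsto (fun s => s ^ (p - 1) * ∫ u in s..b, f u) (𝓝[>] 0) (𝓝 0) := by
  have hp0 : 0 < p - 1 := by linarith
  have hspow := tendsto_rpow_nhdsGT_zero hp0
  rw [Metric.tendsto_nhds]
  intro ε hε
  set η := ε * (p - 1) / 2 with hη
  have hη0 : 0 < η := by positivity
  obtain ⟨a, ha0, ha⟩ := mem_nhdsGT_iff_exists_Ioo_subset.1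
    (((Metric.tendsto_nhds.1 h) η hη0).and (mem_nhdsWithin_of_mem_nhds (gt_mem_nhds hb)))
  have ha0 : 0 < a := ha0
  set d := a / 2
  have hd : d ∈ Ioo 0 a := ⟨half_pos ha0, half_lt_self ha0⟩
  have hdb : d < b := (ha hd).2
  have hlim := (hspow.mul_const |∫ u in d..b, f u|).eventually
    (gt_mem_nhds (show 0 * |∫ u in d..b, f u| < ε / 2 by simpa using half_pos hε))
  filter_upwards [hlim, Ioo_mem_nhdsGT hd.1] with s hs hsd
  have hs0 : 0 < s := hsd.1
  rw [Real.dist_eq, sub_zero]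
  have i1 : IntervalIntegrable f volume s b := hf s hs0 (hsd.2.trans hdb).le
  have i2 : IntervalIntegrable f volume d b := hf d hd.1 hdb.le
  rw [← intervalIntegral.integral_add_adjacent_intervals (i1.trans i2.symm) i2]
  have hbound : |∫ u in s..d, f u| ≤ η * ((s ^ (1 - p) - d ^ (1 - p)) / (p - 1)) := by
    rw [← integral_rpow_neg_eq hs0 hd.1 hp, ← intervalIntegral.integral_const_mul]
    rw [← Real.norm_eq_abs]
    refine intervalIntegral.norm_integral_le_of_norm_le hsd.2.le (ae_of_all _ fun u hu => ?_) ?_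
    · have hu0 : 0 < u := hs0.trans hu.1
      have h1 := (ha ⟨hu0, lt_of_le_of_lt hu.2 hd.2⟩).1
      rw [Real.dist_eq, sub_zero, abs_mul, abs_of_pos (Real.rpow_pos_of_pos hu0 p)] at h1
      rw [Real.norm_eq_abs, Real.rpow_neg hu0.le, ← div_eq_mul_inv,
        le_div_iff₀ (Real.rpow_pos_of_pos hu0 _)]
      exact h1.le
    · refine (intervalIntegral.intervalIntegrable_rpow (Or.inr ?_)).const_mul _
      exact notMem_uIcc_of_lt hs0 hd.1
  have hb2 : η * ((s ^ (1 - p) - d ^ (1 - p)) / (p - 1)) ≤ ε / 2 * s ^ (1 - p) := by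
    have : 0 < d ^ (1 - p) := Real.rpow_pos_of_pos hd.1 _
    rw [hη]
    have e : ε * (p - 1) / 2 * ((s ^ (1 - p) - d ^ (1 - p)) / (p - 1)) =
        ε / 2 * (s ^ (1 - p) - d ^ (1 - p)) := by field_simp
    rw [e]
    gcongr
    linarith
  have hsp : 0 < s ^ (p - 1) := Real.rpow_pos_of_pos hs0 _
  have hone : s ^ (p - 1) * s ^ (1 - p) = 1 := by
    rw [← Real.rpow_add hs0]; simp
  rw [abs_mul, abs_of_pos hsp]
  calc s ^ (p - 1) * |(∫ u in s..d, f u) + ∫ u in d..b, f u|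
      ≤ s ^ (p - 1) * (ε / 2 * s ^ (1 - p) + |∫ u in d..b, f u|) := by
        gcongr
        exact (abs_add_le _ _).trans (add_le_add (hbound.trans hb2) le_rfl)
    _ = ε / 2 * (s ^ (p - 1) * s ^ (1 - p)) + s ^ (p - 1) * |∫ u in d..b, f u| := by ring
    _ < ε := by rw [hone]; linarith

/-- Karamata's theorem at `0` for a function asymptotic to `K u ^ (-p)` with `p > 1`. -/
lemma tendsto_rpow_mul_integral {f : ℝ → ℝ} {b p K : ℝ} (hb : 0 < b) (hp : 1 < p)
    (hf : ∀ s, 0 < s → s ≤ b → IntervalIntegrable f volume s b)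
    (h : Tendsto (fun u => f u * u ^ p) (𝓝[>] 0) (𝓝 K)) :
    Tendsto (fun s => s ^ (p - 1) * ∫ u in s..b, f u) (𝓝[>] 0) (𝓝 (K / (p - 1))) := by
  have hp0 : 0 < p - 1 := by linarith
  have hspow := tendsto_rpow_nhdsGT_zero hp0
  have hpi : ∀ s, 0 < s → IntervalIntegrable (fun u : ℝ => K * u ^ (-p)) volume s b :=
    fun s hs => (intervalIntegral.intervalIntegrable_rpow
      (Or.inr (notMem_uIcc_of_lt hs hb))).const_mul _
  have h0 := tendsto_rpow_mul_integral_of_tendsto_zero (f := fun u => f u - K * u ^ (-p)) hb hp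
    (fun s hs hsb => (hf s hs hsb).sub (hpi s hs)) (by
      have h1 := h.sub_const K
      rw [sub_self] at h1
      refine h1.congr' ?_
      filter_upwards [self_mem_nhdsWithin] with u (hu : 0 < u)
      have : u ^ p ≠ 0 := (Real.rpow_pos_of_pos hu p).ne'
      rw [Real.rpow_neg hu.le]
      field_simp)
  have h1 := h0.add ((hspow.mul_const (b ^ (1 - p))).const_sub 1 |>.const_mul (K / (p - 1)))
  simp only [zero_mul, sub_zero, mul_one, zero_add] at h1
  refine h1.congr' ?_
  filter_upwards [Ioo_mem_nhdsGT hb] with s hs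
  have hone : s ^ (p - 1) * s ^ (1 - p) = 1 := by
    rw [← Real.rpow_add hs.1]; simp
  rw [intervalIntegral.integral_sub (hf s hs.1 hs.2.le) (hpi s hs.1),
    intervalIntegral.integral_const_mul, integral_rpow_neg_eq hs.1 hb hp]
  linear_combination (-(K / (p - 1))) * hone

lemma lsMeasure_of_monotone {g : ℝ → ℝ} (hg : Monotone g) :
    lsMeasure g = hg.stieltjesFunction.measure := dif_pos hg

lemma clampedQuantile_of_mem {F : ℝ → ℝ} {s t u : ℝ} (hu : u ∈ Icc s (1 - t)) :
    clampedQuantile F s t u = quantile F u := by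
  rw [clampedQuantile, min_eq_left hu.2, max_eq_right hu.1]

lemma IsDistributionFunction.monotone_clampedQuantile {F : ℝ → ℝ}
    (hF : IsDistributionFunction F) {s t : ℝ} (hs : 0 < s) (ht : 0 < t) (hst : s ≤ 1 - t) :
    Monotone (clampedQuantile F s t) := by
  have hmem : ∀ u, max s (min u (1 - t)) ∈ Ioo (0 : ℝ) 1 := fun u =>
    ⟨lt_of_lt_of_le hs (le_max_left _ _),
      max_lt (by linarith) (lt_of_le_of_lt (min_le_right _ _) (by linarith))⟩
  exact fun u v huv => hF.monotoneOn_quantile (hmem u) (hmem v)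
    (max_le_max le_rfl (min_le_min huv le_rfl))

lemma IsDistributionFunction.sigmaSq_eq {F : ℝ → ℝ} (hF : IsDistributionFunction F) {s t : ℝ}
    (hs : 0 < s) (ht : 0 < t) (hst : s ≤ 1 - t) :
    sigmaSq F s t =
      s * Function.rightLim (clampedQuantile F s t) s ^ 2 + t * quantile F (1 - t) ^ 2 +
        (∫ u in s..1 - t, quantile F u ^ 2) -
        (s * Function.rightLim (clampedQuantile F s t) s + t * quantile F (1 - t) +
          ∫ u in s..1 - t, quantile F u) ^ 2 := by
  have hg := hF.monotone_clampedQuantile hs ht hst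
  have hB : clampedQuantile F s t (1 - t) = quantile F (1 - t) :=
    clampedQuantile_of_mem ⟨hst, le_rfl⟩
  have h := integral_min_sub_mul_stieltjes hg hs.le hst (by linarith) (fun u hu => by
    rw [clampedQuantile, clampedQuantile, min_eq_right hu, min_self])
  have e1 : ∫ u in s..1 - t, clampedQuantile F s t u ^ 2 = ∫ u in s..1 - t, quantile F u ^ 2 :=
    intervalIntegral.integral_congr fun u hu => by
      rw [uIcc_of_le hst] at hu
      simp only [clampedQuantile_of_mem hu]
  have e2 : ∫ u in s..1 - t, clampedQuantile F s t u = ∫ u in s..1 - t, quantile F u :=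
    intervalIntegral.integral_congr fun u hu => by
      rw [uIcc_of_le hst] at hu
      simp only [clampedQuantile_of_mem hu]
  rw [hB, e1, e2, sub_sub_cancel] at h
  rw [sigmaSq, lsMeasure_of_monotone hg, h]

/-- If `q u * u ^ r` converges as `u → 0+`, then so does `A * s ^ r`, where `A` is the right limit
of `q` at `s`. -/
lemma tendsto_rightLimit_mul_rpow {ι : Type*} {l : Filter ι} {q : ℝ → ℝ} {r L : ℝ}
    (h : Tendsto (fun u => q u * u ^ r) (𝓝[>] 0) (𝓝 L)) {s A : ι → ℝ}
    (hs : Tendsto s l (𝓝[>] 0)) (hA : ∀ᶠ i in l, Tendsto q (𝓝[>] (s i)) (𝓝 (A i))) :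
    Tendsto (fun i => A i * s i ^ r) l (𝓝 L) := by
  rw [(Metric.nhds_basis_closedBall).tendsto_right_iff]
  intro ε hε
  obtain ⟨a, ha0, ha⟩ := mem_nhdsGT_iff_exists_Ioo_subset.1
    (h.eventually (Metric.closedBall_mem_nhds L hε))
  filter_upwards [hs.eventually (Ioo_mem_nhdsGT ha0), hA] with i hi hAi
  have hcont : Tendsto (fun u : ℝ => u ^ r) (𝓝[>] (s i)) (𝓝 (s i ^ r)) :=
    (Real.continuousAt_rpow_const _ _ (Or.inl hi.1.ne')).tendsto.mono_left nhdsWithin_le_nhds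
  refine Metric.isClosed_closedBall.mem_of_tendsto (hAi.mul hcont) ?_
  filter_upwards [Ioo_mem_nhdsGT hi.2] with u hu
  exact ha ⟨hi.1.trans hu.1, hu.2⟩

/-- The variance asymptotics under first-order tail conditions: the contribution of the left tail
is of exact order `s ^ (1 - 2 / α)`, and the only other unbounded contribution is the integral of
the squared quantile function near `1`. -/
lemma IsDistributionFunction.tendsto_sigmaSq_sub_integral {F : ℝ → ℝ}
    (hF : IsDistributionFunction F) {c α c' : ℝ} (hc : 0 < c) (hα1 : 1 < α) (hα2 : α < 2)
    (hc' : 0 < c') (hL : Tendsto (fun x : ℝ => F (-x) * x ^ α) atTop (𝓝 c))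
    (hR : Tendsto (fun x : ℝ => (1 - F x) * x ^ (2 : ℝ)) atTop (𝓝 c'))
    {ι : Type*} {l : Filter ι} {s t : ι → ℝ} (hs : Tendsto s l (𝓝[>] 0))
    (ht : Tendsto t l (𝓝[>] 0)) :
    Tendsto (fun i => s i ^ (2 / α - 1) *
        (sigmaSq F (s i) (t i) - ∫ u in (1 / 2 : ℝ)..1 - t i, quantile F u ^ 2)) l
      (𝓝 (c ^ (2 / α) + c ^ (2 / α) / (2 / α - 1))) := by
  have hα0 : 0 < α := by linarith
  have hp : 1 < 2 / α := by rwa [lt_div_iff₀ hα0, one_mul]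
  have hp0 : 0 < 2 / α - 1 := by linarith
  have hr1 : 1 / α < 1 := by rwa [div_lt_one hα0]
  have hQ := hF.tendsto_quantile_mul_rpow hc hα0 hL
  obtain ⟨M, hM⟩ := hF.exists_abs_quantile_one_sub_mul_rpow_le hc' two_pos hR
  have hmono := hF.monotoneOn_quantile
  have hint : IntegrableOn (quantile F) (Ioo 0 1) := by
    refine hmono.integrableOn_Ioo_of_rpow_bounds (M₀ := |-c ^ (1 / α)| + 1) hr1
      (by norm_num : (1 : ℝ) / 2 < 1) ?_ hM
    filter_upwards [hQ.abs.eventually (gt_mem_nhds (lt_add_one _)), self_mem_nhdsWithin]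
      with u hu (hu0 : 0 < u)
    rw [abs_mul, abs_of_pos (Real.rpow_pos_of_pos hu0 _)] at hu
    exact hu.le
  have hlt : ∀ᶠ x : ℝ in 𝓝[>] 0, x ∈ Ioo (0 : ℝ) (1 / 2) := Ioo_mem_nhdsGT one_half_pos
  have hsI := hs.eventually hlt
  have htI := ht.eventually hlt
  have hpow0 : ∀ r : ℝ, 0 < r → Tendsto (fun i => s i ^ r) l (𝓝 0) := fun r hr =>
    (tendsto_rpow_nhdsGT_zero hr).comp hs
  set A : ι → ℝ := fun i => Function.rightLim (clampedQuantile F (s i) (t i)) (s i) with hAdef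
  have hA : Tendsto (fun i => A i * s i ^ (1 / α)) l (𝓝 (-c ^ (1 / α))) := by
    refine tendsto_rightLimit_mul_rpow hQ hs ?_
    filter_upwards [hsI, htI] with i hi hi'
    have hg := hF.monotone_clampedQuantile hi.1 hi'.1 (by linarith [hi.2, hi'.2])
    refine (hg.tendsto_rightLim (s i)).congr' ?_
    filter_upwards [Ioo_mem_nhdsGT (show s i < 1 - t i by linarith [hi.2, hi'.2])] with u hu
    exact clampedQuantile_of_mem ⟨hu.1.le, hu.2.le⟩
  have hcp : (-c ^ (1 / α)) ^ 2 = c ^ (2 / α) := by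
    rw [neg_sq, ← Real.rpow_natCast, ← Real.rpow_mul hc.le]
    congr 1; push_cast; ring
  have hsq : ∀ x : ℝ, 0 < x → (x ^ (1 / α)) ^ 2 = x ^ (2 / α) := by
    intro x hx
    rw [← Real.rpow_natCast, ← Real.rpow_mul hx.le]
    congr 1; push_cast; ring
  have hT1 : Tendsto (fun i => s i ^ (2 / α - 1) * (s i * A i ^ 2)) l (𝓝 (c ^ (2 / α))) := by
    rw [← hcp]
    refine (hA.pow 2).congr' ?_
    filter_upwards [hsI] with i hi
    rw [mul_pow, hsq _ hi.1, Real.rpow_sub hi.1, Real.rpow_one]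
    have := hi.1.ne'
    field_simp
  have hT2 : Tendsto (fun i => s i ^ (2 / α - 1) * ∫ u in s i..1 / 2, quantile F u ^ 2) l
      (𝓝 (c ^ (2 / α) / (2 / α - 1))) := by
    refine (tendsto_rpow_mul_integral one_half_pos hp (fun x hx hx' =>
      (hmono.mono fun y hy => ⟨hx.trans_le hy.1, by linarith [hy.2]⟩).intervalIntegrable_sq hx')
      ?_).comp hs
    rw [← hcp]
    refine (hQ.pow 2).congr' ?_
    filter_upwards [self_mem_nhdsWithin] with u (hu : 0 < u)
    rw [mul_pow, hsq _ hu]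
  have hsA : Tendsto (fun i => s i * A i) l (𝓝 0) := by
    have h1 := hA.mul (hpow0 (1 - 1 / α) (by linarith))
    rw [mul_zero] at h1
    refine h1.congr' ?_
    filter_upwards [hsI] with i hi
    rw [mul_assoc, ← Real.rpow_add hi.1]
    rw [show 1 / α + (1 - 1 / α) = 1 by ring, Real.rpow_one, mul_comm]
  set J := ∫ u in Ioo 0 1, ‖quantile F u‖
  have hbdd : ∀ᶠ i in l, |t i * quantile F (1 - t i) ^ 2 -
      (s i * A i + t i * quantile F (1 - t i) + ∫ u in s i..1 - t i, quantile F u) ^ 2| ≤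
        M ^ 2 + (1 + M + J) ^ 2 := by
    filter_upwards [hsI, htI, hsA.abs.eventually (gt_mem_nhds (by simp : |(0 : ℝ)| < 1)),
      ht.eventually hM] with i hi hi' hi1 hM1
    have ht0 : 0 ≤ t i := hi'.1.le
    rw [← Real.sqrt_eq_rpow] at hM1
    have hss : √(t i) * √(t i) = t i := Real.mul_self_sqrt ht0
    have hs1 : √(t i) ≤ 1 := Real.sqrt_le_one.2 (by linarith [hi'.2])
    have hM0 : 0 ≤ M := (mul_nonneg (abs_nonneg _) (Real.sqrt_nonneg _)).trans hM1
    have h1 : |t i * quantile F (1 - t i) ^ 2| ≤ M ^ 2 := by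
      have e : t i * quantile F (1 - t i) ^ 2 = (|quantile F (1 - t i)| * √(t i)) ^ 2 := by
        rw [mul_pow, sq_abs, Real.sq_sqrt ht0, mul_comm]
      rw [e, abs_of_nonneg (sq_nonneg _)]
      gcongr
    have h2 : |t i * quantile F (1 - t i)| ≤ M := by
      rw [abs_mul, abs_of_nonneg ht0]
      calc t i * |quantile F (1 - t i)|
          = √(t i) * (|quantile F (1 - t i)| * √(t i)) := by
            linear_combination (-|quantile F (1 - t i)|) * hss
        _ ≤ 1 * M := mul_le_mul hs1 hM1 (by positivity) zero_le_one
        _ = M := one_mul M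
    have h3 : |∫ u in s i..1 - t i, quantile F u| ≤ J := by
      rw [intervalIntegral.integral_of_le (by linarith [hi.2, hi'.2]), ← Real.norm_eq_abs]
      refine (norm_integral_le_integral_norm _).trans ?_
      refine setIntegral_mono_set hint.norm (ae_of_all _ fun u => norm_nonneg _) ?_
      exact LE.le.eventuallyLE fun u hu =>
        ⟨hi.1.trans hu.1, lt_of_le_of_lt hu.2 (by linarith [hi'.1])⟩
    have h4 : |s i * A i + t i * quantile F (1 - t i) + ∫ u in s i..1 - t i, quantile F u| ≤
        1 + M + J :=
      (abs_add_le _ _).trans (add_le_add ((abs_add_le _ _).trans (add_le_add hi1.le h2)) h3)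
    refine (abs_sub _ _).trans (add_le_add h1 ?_)
    rw [abs_pow]
    exact pow_le_pow_left₀ (abs_nonneg _) h4 2
  have hT3 : Tendsto (fun i => s i ^ (2 / α - 1) * (t i * quantile F (1 - t i) ^ 2 -
      (s i * A i + t i * quantile F (1 - t i) + ∫ u in s i..1 - t i, quantile F u) ^ 2)) l
      (𝓝 0) :=
    (hpow0 _ hp0).zero_mul_isBoundedUnder_le ⟨_, hbdd⟩
  have hsum := (hT1.add hT2).add hT3
  rw [add_zero] at hsum
  refine hsum.congr' ?_
  filter_upwards [hsI, htI] with i hi hi'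
  rw [hF.sigmaSq_eq hi.1 hi'.1 (by linarith [hi.2, hi'.2])]
  simp only [hAdef]
  rw [← intervalIntegral.integral_add_adjacent_intervals (a := s i) (b := 1 / 2) (c := 1 - t i)
    (f := fun u => quantile F u ^ 2)
      ((hmono.mono fun y hy =>
        ⟨hi.1.trans_le hy.1, by linarith [hy.2]⟩).intervalIntegrable_sq hi.2.le)
      ((hmono.mono fun y hy =>
        ⟨by linarith [hy.1], by linarith [hy.2, hi'.1]⟩).intervalIntegrable_sq
          (by linarith [hi'.2]))]
  ring

/-- under the second-order tail conditions with `α_R = 2` and `α_L < 2`,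
there is a strictly positive finite constant `C_L`, depending only on `c_L` and `α_L`,
such that `σ²(m/n, k/n) / (C_L (m/n)^(1 - 2/α_L) + ∫_{1/2}^{1-k/n} [F⁻(s)]² ds) → 1`
as `n → ∞`. -/
theorem sigmaSq_ratio_tendsto_of_eq_two_lt_two
    (cL αL : ℝ) (hcL : 0 < cL) (hαL1 : 1 < αL) (hαL2 : αL < 2) :
    ∃ CL : ℝ, 0 < CL ∧
      ∀ (F : ℝ → ℝ) (cR bR bL αR βR βL : ℝ) (m k : ℕ → ℕ),
        IsDistributionFunction F →
        0 < cR → bR ≠ 0 → bL ≠ 0 → 0 < βR → 0 < βL → 1 < αR →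
        RightTailSecondOrder F cR αR bR βR →
        LeftTailSecondOrder F cL αL bL βL →
        αR = 2 →
        Tendsto m atTop atTop →
        Tendsto (fun n : ℕ => (m n : ℝ) / n) atTop (nhds 0) →
        Tendsto k atTop atTop →
        Tendsto (fun n : ℕ => (k n : ℝ) / n) atTop (nhds 0) →
        Tendsto
          (fun n : ℕ =>
            sigmaSq F ((m n : ℝ) / n) ((k n : ℝ) / n) /
              (CL * ((m n : ℝ) / n) ^ (1 - 2 / αL) +
                ∫ s in (1 / 2 : ℝ)..(1 - (k n : ℝ) / n), (quantile F s) ^ 2))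
          atTop (nhds 1) := by
  have hα0 : 0 < αL := by linarith
  have hp0 : 0 < 2 / αL - 1 := by rwa [sub_pos, lt_div_iff₀ hα0, one_mul]
  have hC : 0 < cL ^ (2 / αL) + cL ^ (2 / αL) / (2 / αL - 1) := by
    have := Real.rpow_pos_of_pos hcL (2 / αL)
    positivity
  refine ⟨cL ^ (2 / αL) + cL ^ (2 / αL) / (2 / αL - 1), hC, ?_⟩
  intro F cR bR bL αR βR βL m k hF hcR _ _ hβR hβL _ hRt hLt hαR hm hmn hk hkn
  subst hαR
  have hpos : ∀ j : ℕ → ℕ, Tendsto j atTop atTop →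
      Tendsto (fun n : ℕ => (j n : ℝ) / n) atTop (𝓝 0) →
      Tendsto (fun n : ℕ => (j n : ℝ) / n) atTop (𝓝[>] 0) := by
    intro j hj hjn
    refine tendsto_nhdsWithin_iff.2 ⟨hjn, ?_⟩
    filter_upwards [hj.eventually_gt_atTop 0, eventually_gt_atTop 0] with n hn hn'
    exact div_pos (by exact_mod_cast hn : (0 : ℝ) < j n) (by exact_mod_cast hn')
  have hs := hpos m hm hmn
  have ht := hpos k hk hkn
  have hX := hF.tendsto_sigmaSq_sub_integral hcL hαL1 hαL2 hcR
    (tendsto_mul_rpow_of_second_order hcL hβL hLt)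
    (tendsto_mul_rpow_of_second_order hcR hβR hRt) hs ht
  generalize cL ^ (2 / αL) + cL ^ (2 / αL) / (2 / αL - 1) = C at hC hX ⊢
  have hlim := ((hX.sub_const C).div_const C).abs
  rw [sub_self, zero_div, abs_zero] at hlim
  rw [tendsto_iff_dist_tendsto_zero]
  refine squeeze_zero' (Eventually.of_forall fun _ => dist_nonneg) ?_ hlim
  have hlt : ∀ᶠ x : ℝ in 𝓝[>] 0, x ∈ Ioo (0 : ℝ) (1 / 2) := Ioo_mem_nhdsGT one_half_pos
  filter_upwards [hs.eventually hlt, ht.eventually hlt] with n hn hn'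
  generalize (m n : ℝ) / n = s at hn ⊢
  generalize (k n : ℝ) / n = t at hn' ⊢
  have hI : 0 ≤ ∫ u in (1 / 2 : ℝ)..1 - t, quantile F u ^ 2 :=
    intervalIntegral.integral_nonneg (by linarith [hn'.2]) fun u _ => sq_nonneg _
  generalize (∫ u in (1 / 2 : ℝ)..1 - t, quantile F u ^ 2) = I at hI ⊢
  have hw : 0 < s ^ (2 / αL - 1) := Real.rpow_pos_of_pos hn.1 _
  have hinv : s ^ (1 - 2 / αL) = (s ^ (2 / αL - 1))⁻¹ := by
    rw [← Real.rpow_neg hn.1.le, neg_sub]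
  rw [hinv]
  generalize s ^ (2 / αL - 1) = w at hw ⊢
  have hD : 0 < C + w * I := by positivity
  have e : sigmaSq F s t / (C * w⁻¹ + I) - 1 = (w * (sigmaSq F s t - I) - C) / (C + w * I) := by
    have hD' : C * w⁻¹ + I ≠ 0 := by positivity
    field_simp
    ring
  rw [Real.dist_eq, e, abs_div, abs_div, abs_of_pos hD, abs_of_pos hC]
  gcongr
  linarith [mul_nonneg hw.le hI]
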